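/- Let X, Y be real Hilbert spaces, A, V : X → Y bounded linear operators, ε > 0, 0 < δ ≤ κ < 1, μ_G, μ_F ∈ ℝ, γ_G, γ_F > 0, and let G : X → ℝ be γ_G-strongly convex and F* : Y → ℝ be γ_F-strongly convex. Let (τ_i), (σ_i), (φ_i), (ψ_i) be positive real sequences and set η_i = τ_i φ_i and ω_i = η_i/η_{i+1}; assume for all i: η_i = σ_i ψ_i, φ_{i+1} = φ_i(1 + 2τ_i μ_G), ψ_{i+1} = ψ_i(1 + 2σ_i μ_F), ψ_{i+1} ≥ η_i²‖V‖²/(φ_i(1 − κ)), φ_i ≥ ε η_i ‖A − V‖/δ, and γ_G ≥ (ε/(2ω_i))‖A − V‖ + μ_G. Let sequences (x^i) ⊂ X, (y^i) ⊂ Y satisfy the mismatched Chambolle–Pock iteration: for every i, (1/τ_i)(x^i − x^{i+1}) − V*y^i is a subgradient of G at x^{i+1}, and (1/σ_{i+1})(y^i − y^{i+1}) + A(x^{i+1} + ω_i(x^{i+1} − x^i)) is a subgradient of F* at y^{i+1}. Let (x̂, ŷ) be a fixed point, i.e. −V*ŷ is a subgradient of G at x̂ and A x̂ is a subgradient of F*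 at ŷ. Suppose (Δ_{i+1}) ⊂ ℝ satisfies for every i: ½[(δφ_i − εη_i‖A − V‖)‖x^{i+1} − x^i‖² + ψ_{i+1}‖y^{i+1} − y^i‖² − (η_i²/(φ_i(1 − κ)))‖V*(y^{i+1} − y^i)‖²] + η_{i+1}(γ_F − μ_F − ((1 + ω_i)/(2ε))‖A − V‖)‖y^{i+1} − ŷ‖² ≥ −Δ_{i+1}. Then for every N ≥ 1: ½[φ_N‖x^N − x̂‖² − 2η_N⟨V(x^N − x̂), y^N − ŷ⟩ + ψ_{N+1}‖y^N − ŷ‖²] ≤ ½[φ_0‖x^0 − x̂‖² − 2η_0⟨V(x^0 − x̂), y^0 − ŷ⟩ + ψ_1‖y^0 − ŷ‖²] + Σ_{i=0}^{N−1} Δ_{i+1}. -/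

import Mathlib

open scoped RealInnerProductSpace

/-- `g` is a subgradient of `f : E → ℝ` at `x`. -/
def HasSubgradientAt {E : Type*} [NormedAddCommGroup E] [InnerProductSpace ℝ E]
    (f : E → ℝ) (g x : E) : Prop :=
  ∀ u, f x + ⟪g, u - x⟫ ≤ f u

/-- `f` is `γ`-strongly convex: `u ↦ f u - γ/2 * ‖u‖²` is convex. -/
def StronglyConvexWith {E : Type*} [NormedAddCommGroup E] [InnerProductSpace ℝ E]
    (γ : ℝ) (f : E → ℝ) : Prop :=
  ConvexOn ℝ Set.univ (fun u => f u - γ / 2 * ‖u‖ ^ 2)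

theorem strong_subgrad {E : Type*} [NormedAddCommGroup E] [InnerProductSpace ℝ E]
    {γ : ℝ} {f : E → ℝ} (hγ : 0 < γ) (hf : StronglyConvexWith γ f) {g u : E}
    (hg : HasSubgradientAt f g u) (w : E) :
    f u + ⟪g, w - u⟫ + γ / 2 * ‖w - u‖ ^ 2 ≤ f w := by
  have hs : StrongConvexOn Set.univ γ f := strongConvexOn_iff_convex.2 hf
  have key : ∀ t : ℝ, 0 < t → t ≤ 1 →
      (1 - t) * (γ / 2 * ‖w - u‖ ^ 2) ≤ f w - f u - ⟪g, w - u⟫ := by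
    intro t ht ht1
    have h1 := hs.2 (Set.mem_univ u) (Set.mem_univ w) (sub_nonneg.2 ht1) ht.le (by ring)
    have h2 := hg ((1 - t) • u + t • w)
    have e : (1 - t) • u + t • w - u = t • (w - u) := by module
    rw [e, inner_smul_right] at h2
    rw [norm_sub_rev u w] at h1
    simp only [smul_eq_mul] at h1
    have h3 : t * ((1 - t) * (γ / 2 * ‖w - u‖ ^ 2)) ≤ t * (f w - f u - ⟪g, w - u⟫) := by
      linarith
    exact le_of_mul_le_mul_left h3 ht
  have h0 := key 1 one_pos le_rfl
  have hK : 0 ≤ γ / 2 * ‖w - u‖ ^ 2 := by positivity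
  generalize γ / 2 * ‖w - u‖ ^ 2 = K at *
  by_contra hc
  push Not at hc
  have hKp : 0 < K := by linarith
  have h4 := key ((K - (f w - f u - ⟪g, w - u⟫)) / (2 * K))
    (by apply div_pos <;> linarith) (by rw [div_le_one (by linarith)]; linarith)
  have h5 : (1 - (K - (f w - f u - ⟪g, w - u⟫)) / (2 * K)) * K
      = (K + (f w - f u - ⟪g, w - u⟫)) / 2 := by
    field_simp; ring
  rw [h5] at h4
  linarith

theorem strong_mono {E : Type*} [NormedAddCommGroup E] [InnerProductSpace ℝ E]
    {γ : ℝ} {f : E → ℝ} (hγ : 0 < γ) (hf : StronglyConvexWith γ f) {g u h v : E}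
    (hg : HasSubgradientAt f g u) (hh : HasSubgradientAt f h v) :
    γ * ‖u - v‖ ^ 2 ≤ ⟪g - h, u - v⟫ := by
  have h1 := strong_subgrad hγ hf hg v
  have h2 := strong_subgrad hγ hf hh u
  rw [norm_sub_rev v u, ← neg_sub u v, inner_neg_right] at h1
  rw [inner_sub_left]
  linarith

theorem young_op {X Y : Type*}
    [NormedAddCommGroup X] [InnerProductSpace ℝ X]
    [NormedAddCommGroup Y] [InnerProductSpace ℝ Y]
    (M : X →L[ℝ] Y) {ε : ℝ} (hε : 0 < ε) (d : X) (b : Y) :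
    ⟪M d, b⟫ ≤ ‖M‖ * (ε / 2 * ‖d‖ ^ 2 + 1 / (2 * ε) * ‖b‖ ^ 2) := by
  have h1 : ⟪M d, b⟫ ≤ ‖M‖ * (‖d‖ * ‖b‖) := by
    calc ⟪M d, b⟫ ≤ ‖M d‖ * ‖b‖ := real_inner_le_norm _ _
      _ ≤ (‖M‖ * ‖d‖) * ‖b‖ := by gcongr; exact M.le_opNorm d
      _ = _ := by ring
  refine h1.trans (mul_le_mul_of_nonneg_left ?_ (norm_nonneg _))
  have : ε / 2 * ‖d‖ ^ 2 + 1 / (2 * ε) * ‖b‖ ^ 2 - ‖d‖ * ‖b‖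
      = (ε * ‖d‖ - ‖b‖) ^ 2 / (2 * ε) := by
    field_simp; ring
  have : 0 ≤ (ε * ‖d‖ - ‖b‖) ^ 2 / (2 * ε) := by positivity
  linarith

theorem statement7 {X Y : Type*}
    [NormedAddCommGroup X] [InnerProductSpace ℝ X] [CompleteSpace X]
    [NormedAddCommGroup Y] [InnerProductSpace ℝ Y] [CompleteSpace Y]
    (A V : X →L[ℝ] Y)
    (ε δ κ μG μF γG γF : ℝ)
    (hε : 0 < ε) (hδ : 0 < δ) (hδκ : δ ≤ κ) (hκ : κ < 1)
    (hγG : 0 < γG) (hγF : 0 < γF)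
    (G : X → ℝ) (Fstar : Y → ℝ)
    (hG : StronglyConvexWith γG G)
    (hFstar : StronglyConvexWith γF Fstar)
    (τ σ φ ψ η ω : ℕ → ℝ)
    (hτpos : ∀ i, 0 < τ i) (hσpos : ∀ i, 0 < σ i)
    (hφpos : ∀ i, 0 < φ i) (hψpos : ∀ i, 0 < ψ i)
    (hη : ∀ i, η i = τ i * φ i)
    (hω : ∀ i, ω i = η i / η (i + 1))
    (hησψ : ∀ i, η i = σ i * ψ i)
    (hφrec : ∀ i, φ (i + 1) = φ i * (1 + 2 * τ i * μG))
    (hψrec : ∀ i, ψ (i + 1) = ψ i * (1 + 2 * σ i * μF))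
    (hψbound : ∀ i, ψ (i + 1) ≥ η i ^ 2 * ‖V‖ ^ 2 / (φ i * (1 - κ)))
    (hφbound : ∀ i, φ i ≥ ε * η i * ‖A - V‖ / δ)
    (hγGbound : ∀ i, γG ≥ ε / (2 * ω i) * ‖A - V‖ + μG)
    (x : ℕ → X) (y : ℕ → Y)
    (hx : ∀ i, HasSubgradientAt G
      ((1 / τ i) • (x i - x (i + 1)) - ContinuousLinearMap.adjoint V (y i)) (x (i + 1)))
    (hy : ∀ i, HasSubgradientAt Fstar
      ((1 / σ (i + 1)) • (y i - y (i + 1)) + A (x (i + 1) + ω i • (x (i + 1) - x i)))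
      (y (i + 1)))
    (xh : X) (yh : Y)
    (hxh : HasSubgradientAt G (-(ContinuousLinearMap.adjoint V yh)) xh)
    (hyh : HasSubgradientAt Fstar (A xh) yh)
    (Δ : ℕ → ℝ)
    (hΔ : ∀ i, (1 / 2) * ((δ * φ i - ε * η i * ‖A - V‖) * ‖x (i + 1) - x i‖ ^ 2
          + ψ (i + 1) * ‖y (i + 1) - y i‖ ^ 2
          - η i ^ 2 / (φ i * (1 - κ)) *
              ‖ContinuousLinearMap.adjoint V (y (i + 1) - y i)‖ ^ 2)
        + η (i + 1) * (γF - μF - (1 + ω i) / (2 * ε) * ‖A - V‖) * ‖y (i + 1) - yh‖ ^ 2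
        ≥ -Δ (i + 1)) :
    ∀ N : ℕ, 1 ≤ N →
      (1 / 2) * (φ N * ‖x N - xh‖ ^ 2 - 2 * η N * ⟪V (x N - xh), y N - yh⟫
          + ψ (N + 1) * ‖y N - yh‖ ^ 2) ≤
        (1 / 2) * (φ 0 * ‖x 0 - xh‖ ^ 2 - 2 * η 0 * ⟪V (x 0 - xh), y 0 - yh⟫
          + ψ 1 * ‖y 0 - yh‖ ^ 2) + ∑ i ∈ Finset.range N, Δ (i + 1) := by
  have hηpos : ∀ i, 0 < η i := fun i => by rw [hη]; exact mul_pos (hτpos i) (hφpos i)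
  have step : ∀ i, (1 / 2) * (φ (i+1) * ‖x (i+1) - xh‖ ^ 2
        - 2 * η (i+1) * ⟪V (x (i+1) - xh), y (i+1) - yh⟫
        + ψ (i + 1 + 1) * ‖y (i+1) - yh‖ ^ 2) ≤
      (1 / 2) * (φ i * ‖x i - xh‖ ^ 2 - 2 * η i * ⟪V (x i - xh), y i - yh⟫
        + ψ (i + 1) * ‖y i - yh‖ ^ 2) + Δ (i + 1) := by
    intro i
    have mG := strong_mono hγG hG (hx i) hxh
    have mF := strong_mono hγF hFstar (hy i) hyh
    have hD := hΔ i
    have hηω : η (i+1) * ω i = η i := by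
      rw [hω]; field_simp [(hηpos (i+1)).ne']
    have hωpos : 0 < ω i := by rw [hω]; exact div_pos (hηpos _) (hηpos _)
    have hτφ := hη i
    have hσψ := hησψ (i+1)
    have hφr := hφrec i
    have hψr := hψrec (i+1)
    have hgb := hγGbound i
    have p1 := hηpos i
    have p2 := hηpos (i+1)
    have p3 := hφpos i
    have t1 := hτpos i
    have s1 := hσpos (i+1)
    obtain ⟨a, ha⟩ : ∃ a, a = x i - xh := ⟨_, rfl⟩
    obtain ⟨b, hb⟩ : ∃ b, b = y i - yh := ⟨_, rfl⟩
    obtain ⟨d, hd⟩ : ∃ d, d = x (i+1) - x i := ⟨_, rfl⟩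
    obtain ⟨e, he⟩ : ∃ e, e = y (i+1) - y i := ⟨_, rfl⟩
    have ha' : x (i+1) - xh = a + d := by rw [ha, hd]; abel
    have hb' : y (i+1) - yh = b + e := by rw [hb, he]; abel
    have eG : (1 / τ i) • (x i - x (i + 1)) - ContinuousLinearMap.adjoint V (y i)
        - -(ContinuousLinearMap.adjoint V yh)
        = -((1 / τ i) • d) - ContinuousLinearMap.adjoint V b := by
      rw [hd, hb, map_sub]; module
    have eF : (1 / σ (i + 1)) • (y i - y (i + 1)) + A (x (i + 1) + ω i • (x (i + 1) - x i)) - A xh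
        = -((1 / σ (i+1)) • e) + (A (a + d) + ω i • A d) := by
      rw [← ha', he, hd]; simp only [map_add, map_sub, map_smul]; module
    rw [eG, ha', inner_sub_left, inner_neg_left, real_inner_smul_left,
      ContinuousLinearMap.adjoint_inner_left, real_inner_comm] at mG
    rw [eF, hb', inner_add_left, inner_neg_left, real_inner_smul_left, inner_add_left,
      real_inner_smul_left] at mF
    rw [ha', hb', ← ha, ← hb]
    rw [hb', ← hd, ← he] at hD
    have y1 := young_op (A - V) hε d (b + e)
    have y2 := young_op (A - V) hε (a + d) (b + e)
    have hc : 0 < φ i * (1 - κ) := mul_pos p3 (by linarith)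
    have y3 : η i * ⟪V d, e⟫ ≤ φ i * (1 - κ) / 2 * ‖d‖ ^ 2
        + (1 / 2) * (η i ^ 2 / (φ i * (1 - κ)) * ‖ContinuousLinearMap.adjoint V e‖ ^ 2) := by
      rw [← ContinuousLinearMap.adjoint_inner_right]
      have h1 := real_inner_le_norm d (ContinuousLinearMap.adjoint V e)
      generalize ‖ContinuousLinearMap.adjoint V e‖ = n at *
      have h2 := mul_le_mul_of_nonneg_left h1 p1.le
      generalize φ i * (1 - κ) = c at *
      have h3 : c / 2 * ‖d‖ ^ 2 + (1 / 2) * (η i ^ 2 / c * n ^ 2) - η i * (‖d‖ * n)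
          = (c * ‖d‖ - η i * n) ^ 2 / (2 * c) := by
        field_simp; ring
      have h4 : 0 ≤ (c * ‖d‖ - η i * n) ^ 2 / (2 * c) := by positivity
      linarith
    -- scaled monotonicity
    have mG' := mul_le_mul_of_nonneg_left mG p1.le
    have mF' := mul_le_mul_of_nonneg_left mF p2.le
    have y1' := mul_le_mul_of_nonneg_left y1 p1.le
    have y2' := mul_le_mul_of_nonneg_left y2 p2.le
    have eτ : η i * (1 / τ i) = φ i := by rw [hτφ]; field_simp
    have eσ : η (i+1) * (1 / σ (i+1)) = ψ (i+1) := by rw [hσψ]; field_simp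
    have hgb' : η i * μG + η (i+1) * (ε / 2 * ‖A - V‖) ≤ η i * γG := by
      have h := mul_le_mul_of_nonneg_left hgb p1.le
      have h2 : η i * (ε / (2 * ω i) * ‖A - V‖ + μG)
          = η i * μG + η (i+1) * (ε / 2 * ‖A - V‖) := by
        rw [← hηω]; field_simp; ring
      linarith
    have hgb2 := mul_le_mul_of_nonneg_right hgb' (sq_nonneg ‖a + d‖)
    have hδd : δ * φ i * ‖d‖ ^ 2 ≤ κ * φ i * ‖d‖ ^ 2 := by gcongr
    have eφ : φ (i+1) = φ i + 2 * η i * μG := by rw [hφr, hτφ]; ring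
    have eψ : ψ (i+1+1) = ψ (i+1) + 2 * η (i+1) * μF := by rw [hψr, hσψ]; ring
    have eD : η (i + 1) * (γF - μF - (1 + ω i) / (2 * ε) * ‖A - V‖)
        = η (i+1) * γF - η (i+1) * μF - (η (i+1) + η i) * (1 / (2 * ε)) * ‖A - V‖ := by
      rw [← hηω]; field_simp
    rw [eD] at hD
    have mG2 : η i * γG * ‖a + d‖ ^ 2 ≤ -(φ i * ⟪d, a + d⟫) - η i * ⟪V (a + d), b⟫ := by
      rw [← eτ]; rw [real_inner_comm] at mG'; first | linarith | (simp only [real_inner_comm] at *; linarith)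
    have mF2 : η (i+1) * γF * ‖b + e‖ ^ 2 ≤ -(ψ (i+1) * ⟪e, b + e⟫)
        + η (i+1) * ⟪A (a + d), b + e⟫ + η i * ⟪A d, b + e⟫ := by
      rw [← eσ, ← hηω]; linarith
    rw [eφ, eψ]
    have na : ‖a + d‖ ^ 2 = ‖a‖ ^ 2 + 2 * ⟪a, d⟫ + ‖d‖ ^ 2 := norm_add_sq_real a d
    have nb : ‖b + e‖ ^ 2 = ‖b‖ ^ 2 + 2 * ⟪b, e⟫ + ‖e‖ ^ 2 := norm_add_sq_real b e
    have ia : ⟪d, a + d⟫ = (‖a + d‖ ^ 2 - ‖a‖ ^ 2 + ‖d‖ ^ 2) / 2 := by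
      rw [na, inner_add_right, real_inner_self_eq_norm_sq, real_inner_comm]; ring
    have ib : ⟪e, b + e⟫ = (‖b + e‖ ^ 2 - ‖b‖ ^ 2 + ‖e‖ ^ 2) / 2 := by
      rw [nb, inner_add_right, real_inner_self_eq_norm_sq, real_inner_comm]; ring
    have eA1 : ⟪A (a + d), b + e⟫ = ⟪V (a + d), b + e⟫ + ⟪(A - V) (a + d), b + e⟫ := by
      rw [← inner_add_left]; simp
    have eA2 : ⟪A d, b + e⟫ = ⟪V d, b⟫ + ⟪V d, e⟫ + ⟪(A - V) d, b + e⟫ := by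
      rw [← inner_add_right, ← inner_add_left]; simp
    have eV : ⟪V (a + d), b⟫ = ⟪V a, b⟫ + ⟪V d, b⟫ := by
      rw [map_add, inner_add_left]
    rw [ia, eV] at mG2
    rw [ib, eA1, eA2] at mF2
    clear na nb ia ib eA1 eA2 eV
    linarith
  intro N _
  induction N with
  | zero => simp
  | succ n ih =>
    rw [Finset.sum_range_succ]
    rcases Nat.eq_zero_or_pos n with h | h
    · subst h
      simpa using step 0
    · have := step n
      have := ih h
      linarith
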